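/- arXiv:2112.12646 — 2 statements merged into one kernel-verified Lean document; each statement's English description precedes it below -/
import Mathlib

section
/- F(S¹) is homeomorphic to the Hilbert cube. -/
/-- `F(S¹)` as a subset of the Banach space `C([0,π], ℝ)` with the sup norm. -/
def FS1c : Set C(Set.Icc (0 : ℝ) Real.pi, ℝ) :=
  {f | LipschitzWith 1 ⇑f ∧
    f ⟨0, Set.left_mem_Icc.2 Real.pi_pos.le⟩ +
      f ⟨Real.pi, Set.right_mem_Icc.2 Real.pi_pos.le⟩ = Real.pi}

section

open Set Filter Topology Uniformity

/-- A set of surjections between compact metrizable spaces, each of which can be approximated by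
members with arbitrarily small fibres, has a homeomorphism in its closure. -/
theorem nonempty_homeomorph_of_approx {X Y : Type*} [UniformSpace X] [UniformSpace Y]
    [CompactSpace X] [CompactSpace Y] [T0Space X] [T0Space Y]
    [IsCountablyGenerated (𝓤 X)] [IsCountablyGenerated (𝓤 Y)]
    (S : Set C(X, Y)) (hne : S.Nonempty) (hsurj : ∀ g ∈ S, Function.Surjective g)
    (happrox : ∀ g ∈ S, ∀ U ∈ 𝓤 Y, ∀ V ∈ 𝓤 X, ∃ g' ∈ S, (∀ x, (g x, g' x) ∈ U) ∧
      ∀ x x', g' x = g' x' → (x, x') ∈ V) : Nonempty (X ≃ₜ Y) := by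
  let : MetricSpace X := UniformSpace.metricSpace X
  let : MetricSpace Y := UniformSpace.metricSpace Y
  have : Nonempty (closure S) := hne.closure.to_subtype
  have : CompleteSpace (closure S) := isClosed_closure.completeSpace_coe
  let U : ℕ → Set (closure S) := fun k =>
    {g | ∀ p ∈ {p : X × X | 1 / ((k : ℝ) + 1) ≤ dist p.1 p.2}, (g : C(X, Y)) p.1 ≠ (g : C(X, Y)) p.2}
  have hopen : ∀ k, IsOpen (U k) := by
    intro k
    have hC : IsCompact {p : X × X | 1 / ((k : ℝ) + 1) ≤ dist p.1 p.2} :=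
      (isClosed_le continuous_const continuous_dist).isCompact
    rw [isOpen_iff_mem_nhds]
    intro g hg
    refine hC.eventually_forall_of_forall_eventually fun p hp => ?_
    have hc : Continuous fun z : closure S × (X × X) =>
        ((z.1 : C(X, Y)) z.2.1, (z.1 : C(X, Y)) z.2.2) := by fun_prop
    exact (isClosed_diagonal.isOpen_compl.preimage hc).mem_nhds (x := (g, p)) (hg p hp)
  have hdense : ∀ k, Dense (U k) := by
    intro k
    rw [Metric.dense_iff]
    rintro ⟨g, hg⟩ r hr
    obtain ⟨g₁, hg₁, h₁⟩ := Metric.mem_closure_iff.1 hg (r / 2) (by positivity)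
    obtain ⟨g₂, hg₂, h₂, h₃⟩ := happrox g₁ hg₁ _ (Metric.dist_mem_uniformity (ε := r / 3) (by positivity))
      _ (Metric.dist_mem_uniformity (ε := 1 / ((k : ℝ) + 1)) (by positivity))
    refine ⟨⟨g₂, subset_closure hg₂⟩, ?_, ?_⟩
    · have : dist g₁ g₂ ≤ r / 3 :=
        (ContinuousMap.dist_le (by positivity)).2 fun x => (h₂ x).le
      rw [Metric.mem_ball, Subtype.dist_eq, dist_comm]
      calc dist g g₂ ≤ dist g g₁ + dist g₁ g₂ := dist_triangle _ _ _
        _ < r := by linarith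
    · intro p hp h
      exact absurd (show dist p.1 p.2 < _ from h₃ _ _ h) (not_lt.2 hp)
  obtain ⟨⟨g, hgS⟩, hg⟩ := (dense_iInter_of_isOpen_nat hopen hdense).nonempty
  have hinj : Function.Injective g := by
    intro x x' h
    by_contra hxx
    obtain ⟨k, hk⟩ := exists_nat_one_div_lt (dist_pos.2 hxx)
    exact mem_iInter.1 hg k (x, x') hk.le h
  have hsur : Function.Surjective g := by
    intro y
    have : y ∈ closure (range g) := by
      rw [Metric.mem_closure_iff]
      intro ε hε
      obtain ⟨g₁, hg₁, h₁⟩ := Metric.mem_closure_iff.1 hgS ε hε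
      obtain ⟨x, rfl⟩ := hsurj g₁ hg₁ y
      exact ⟨g x, mem_range_self x, by
        rw [dist_comm]; exact (ContinuousMap.dist_apply_le_dist x).trans_lt h₁⟩
    rwa [(isCompact_range g.continuous).isClosed.closure_eq] at this
  exact ⟨Continuous.homeoOfEquivCompactToT2 (f := Equiv.ofBijective g ⟨hinj, hsur⟩) g.continuous⟩

theorem exists_forall_lt_of_mem_uniformity_pi {V : Set ((ℕ → ℝ) × (ℕ → ℝ))}
    (hV : V ∈ 𝓤 (ℕ → ℝ)) : ∃ m : ℕ, ∃ ε > 0, ∀ a b : ℕ → ℝ, (∀ i < m, |a i - b i| < ε) → (a, b) ∈ V := by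
  have hb := Filter.HasBasis.iInf fun i : ℕ =>
    (Metric.uniformity_basis_dist (α := ℝ)).comap fun p : (ℕ → ℝ) × (ℕ → ℝ) => (p.1 i, p.2 i)
  rw [Pi.uniformity, hb.mem_iff] at hV
  obtain ⟨⟨I, r⟩, ⟨hI, hr⟩, hV⟩ := hV
  obtain ⟨m, hm⟩ := hI.bddAbove
  have : Finite I := hI
  obtain ⟨ε, hε, hεr⟩ : ∃ ε > 0, ∀ i, ε ≤ r i := by
    cases isEmpty_or_nonempty I with
    | inl h => exact ⟨1, one_pos, fun i => h.elim i⟩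
    | inr h =>
      obtain ⟨j, hj⟩ := Finite.exists_min r
      exact ⟨r j, hr j, hj⟩
  refine ⟨m + 1, ε, hε, fun a b hab => hV (mem_iInter.2 fun i => ?_)⟩
  exact (hab i (Nat.lt_succ_of_le (hm i.2))).trans_le (hεr i)

/-- The slope on the `n`-th dyadic interval of the function with Faber–Schauder coefficients `y`.
The children of the interval `n ≥ 1` are `2 * n` and `2 * n + 1`. -/
noncomputable def schauderSlope (y : ℕ → ℝ) : ℕ → ℝ
  | 0 => 0
  | n + 1 => schauderSlope y ((n + 1) / 2) + (-1) ^ (n + 1) * y ((n + 1) / 2)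
decreasing_by omega

/-- The largest slope forced by the first `n` Faber–Schauder coefficients. -/
noncomputable def schauderGauge (y : ℕ → ℝ) : ℕ → ℝ
  | 0 => 0
  | n + 1 => max (schauderGauge y n) (|schauderSlope y n| + |y n|)

theorem schauderSlope_zero (y : ℕ → ℝ) : schauderSlope y 0 = 0 := by rw [schauderSlope]

theorem schauderSlope_succ (y : ℕ → ℝ) (n : ℕ) : schauderSlope y (n + 1) =
    schauderSlope y ((n + 1) / 2) + (-1) ^ (n + 1) * y ((n + 1) / 2) := by rw [schauderSlope]

theorem schauderGauge_succ (y : ℕ → ℝ) (n : ℕ) : schauderGauge y (n + 1) =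
    max (schauderGauge y n) (|schauderSlope y n| + |y n|) := rfl

theorem continuous_schauderSlope (n : ℕ) : Continuous fun y => schauderSlope y n := by
  induction n using Nat.strong_induction_on with
  | _ n ih =>
    cases n with
    | zero => simpa only [schauderSlope_zero] using continuous_const
    | succ n =>
      simp only [schauderSlope_succ]
      exact (ih _ (by omega)).add (by fun_prop)

theorem continuous_schauderGauge (n : ℕ) : Continuous fun y => schauderGauge y n := by
  induction n with
  | zero => exact continuous_const
  | succ n ih =>
    simp only [schauderGauge_succ]
    have := continuous_schauderSlope n
    fun_prop

theorem schauderSlope_of_eq_smul {x y : ℕ → ℝ} {c : ℝ} {n : ℕ} (h : ∀ i < n, x i = c * y i) :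
    schauderSlope x n = c * schauderSlope y n := by
  induction n using Nat.strong_induction_on with
  | _ n ih =>
    cases n with
    | zero => simp [schauderSlope_zero]
    | succ n =>
      rw [schauderSlope_succ, schauderSlope_succ,
        ih _ (by omega) fun i hi => h i (by omega), h _ (by omega)]
      ring

theorem schauderSlope_congr {x y : ℕ → ℝ} {n : ℕ} (h : ∀ i < n, x i = y i) :
    schauderSlope x n = schauderSlope y n := by
  simpa using schauderSlope_of_eq_smul (c := 1) fun i hi => by simpa using h i hi

theorem schauderGauge_of_eq_smul {x y : ℕ → ℝ} {c : ℝ} (hc : 0 ≤ c) {n : ℕ}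
    (h : ∀ i < n, x i = c * y i) : schauderGauge x n = c * schauderGauge y n := by
  induction n with
  | zero => simp [schauderGauge]
  | succ n ih =>
    rw [schauderGauge_succ, schauderGauge_succ, ih fun i hi => h i (by omega),
      schauderSlope_of_eq_smul fun i hi => h i (by omega), h n (by omega),
      mul_max_of_nonneg _ _ hc, abs_mul, abs_mul, abs_of_nonneg hc]
    ring_nf

theorem schauderGauge_congr {x y : ℕ → ℝ} {n : ℕ} (h : ∀ i < n, x i = y i) :
    schauderGauge x n = schauderGauge y n := by
  simpa using schauderGauge_of_eq_smul zero_le_one fun i hi => by simpa using h i hi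

theorem schauderGauge_mono (y : ℕ → ℝ) : Monotone (schauderGauge y) :=
  monotone_nat_of_le_succ fun _ => le_max_left _ _

theorem schauderGauge_nonneg (y : ℕ → ℝ) (n : ℕ) : 0 ≤ schauderGauge y n :=
  schauderGauge_mono y (Nat.zero_le n)

theorem abs_slope_add_abs_le_gauge (y : ℕ → ℝ) {k n : ℕ} (h : k < n) :
    |schauderSlope y k| + |y k| ≤ schauderGauge y n :=
  (le_max_right _ _).trans (schauderGauge_mono y h)

theorem abs_le_schauderGauge (y : ℕ → ℝ) {k n : ℕ} (h : k < n) : |y k| ≤ schauderGauge y n :=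
  (le_add_of_nonneg_left (abs_nonneg _)).trans (abs_slope_add_abs_le_gauge y h)

theorem abs_schauderSlope_le_gauge (y : ℕ → ℝ) (n : ℕ) :
    |schauderSlope y n| ≤ schauderGauge y n := by
  cases n with
  | zero => simp [schauderSlope_zero, schauderGauge]
  | succ n =>
    rw [schauderSlope_succ]
    refine (abs_add_le _ _).trans ?_
    rw [abs_mul, abs_pow, abs_neg, abs_one, one_pow, one_mul]
    exact abs_slope_add_abs_le_gauge y (by omega)

/-- The sequences whose first `n` terms are Faber–Schauder coefficients of a `1`-Lipschitz
function, and whose other terms are arbitrary parameters in `[-1, 1]`. -/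
def schauderStage (n : ℕ) : Set (ℕ → ℝ) := {x | schauderGauge x n ≤ 1 ∧ ∀ j ≥ n, |x j| ≤ 1}

/-- The Faber–Schauder coefficient sequences of `1`-Lipschitz functions. -/
def schauderSet : Set (ℕ → ℝ) := {x | ∀ n, schauderGauge x n ≤ 1}

theorem abs_le_one_of_mem_stage {n : ℕ} {x : ℕ → ℝ} (hx : x ∈ schauderStage n) (j : ℕ) :
    |x j| ≤ 1 := by
  rcases lt_or_ge j n with h | h
  · exact (abs_le_schauderGauge x h).trans hx.1
  · exact hx.2 j h

theorem isCompact_of_isClosed_of_abs_le_one {s : Set (ℕ → ℝ)} (hs : IsClosed s)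
    (h : ∀ x ∈ s, ∀ j, |x j| ≤ 1) : IsCompact s :=
  (isCompact_univ_pi fun _ : ℕ => isCompact_Icc (a := (-1 : ℝ)) (b := 1)).of_isClosed_subset hs
    fun x hx j _ => abs_le.1 (h x hx j)

theorem isCompact_schauderStage (n : ℕ) : IsCompact (schauderStage n) := by
  refine isCompact_of_isClosed_of_abs_le_one ?_ fun x hx => abs_le_one_of_mem_stage hx
  have h₁ : IsClosed {x : ℕ → ℝ | ∀ j ≥ n, |x j| ≤ 1} := by
    simp only [ofPred_forall]
    exact isClosed_iInter fun j => isClosed_iInter fun _ =>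
      isClosed_le (by fun_prop) continuous_const
  exact (isClosed_le (continuous_schauderGauge n) continuous_const).inter h₁

theorem isCompact_schauderSet : IsCompact schauderSet := by
  refine isCompact_of_isClosed_of_abs_le_one ?_ fun x hx j =>
    (abs_le_schauderGauge x j.lt_succ_self).trans (hx _)
  simp only [schauderSet, ofPred_forall]
  exact isClosed_iInter fun n => isClosed_le (continuous_schauderGauge n) continuous_const

/-- Read the terms of `x` from the `n`-th on as relative positions of the Faber–Schauder
coefficients in the intervals that the preceding ones allow. -/
noncomputable def schauderFill (n : ℕ) (x : ℕ → ℝ) : ℕ → ℝ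
  | j => if j < n then x j else
    x j * (1 - |schauderSlope (fun i => if _h : i < j then schauderFill n x i else 0) j|)

theorem schauderFill_of_lt {n j : ℕ} (x : ℕ → ℝ) (h : j < n) : schauderFill n x j = x j := by
  rw [schauderFill, if_pos h]

theorem schauderFill_of_le {n j : ℕ} (x : ℕ → ℝ) (h : n ≤ j) :
    schauderFill n x j = x j * (1 - |schauderSlope (schauderFill n x) j|) := by
  rw [schauderFill, if_neg h.not_gt]
  congr 3
  exact schauderSlope_congr fun i hi => by simp [hi]

theorem continuous_schauderFill (n : ℕ) : Continuous (schauderFill n) := by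
  refine continuous_pi fun j => ?_
  induction j using Nat.strong_induction_on with
  | _ j ih =>
    rcases lt_or_ge j n with h | h
    · simp only [schauderFill_of_lt _ h]
      fun_prop
    · have hslope : Continuous fun x => schauderSlope (schauderFill n x) j := by
        have : Continuous fun (x : ℕ → ℝ) (i : ℕ) => if i < j then schauderFill n x i else 0 := by
          refine continuous_pi fun i => ?_
          by_cases hi : i < j
          · simpa [hi] using ih i hi
          · simpa [hi] using continuous_const
        refine ((continuous_schauderSlope j).comp this).congr fun x => ?_
        exact schauderSlope_congr fun i hi => by simp [hi]
      simp only [schauderFill_of_le _ h]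
      fun_prop

theorem schauderFill_mem {n : ℕ} {x : ℕ → ℝ} (hx : x ∈ schauderStage n) :
    schauderFill n x ∈ schauderSet := by
  intro k
  induction k with
  | zero => simp [schauderGauge]
  | succ k ih =>
    rcases lt_or_ge k n with h | h
    · rw [schauderGauge_congr fun i hi => schauderFill_of_lt x (by omega)]
      exact (schauderGauge_mono x h).trans hx.1
    · refine max_le ih ?_
      have h₁ := (abs_schauderSlope_le_gauge (schauderFill n x) k).trans ih
      rw [schauderFill_of_le x h, abs_mul, abs_of_nonneg (sub_nonneg.2 h₁)]
      have := mul_le_mul_of_nonneg_right (hx.2 k h) (sub_nonneg.2 h₁)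
      linarith

theorem exists_schauderFill_eq (n : ℕ) {y : ℕ → ℝ} (hy : y ∈ schauderSet) :
    ∃ x ∈ schauderStage n, schauderFill n x = y := by
  have hb : ∀ j, |schauderSlope y j| + |y j| ≤ 1 := fun j =>
    (abs_slope_add_abs_le_gauge y j.lt_succ_self).trans (hy _)
  refine ⟨fun j => if j < n then y j else y j / (1 - |schauderSlope y j|), ⟨?_, ?_⟩, ?_⟩
  · rw [schauderGauge_congr (y := y) fun i hi => by simp [hi]]
    exact hy n
  · intro j hj
    simp only [hj.not_gt, if_false]
    have := hb j
    rw [abs_div, abs_of_nonneg (a := 1 - _) (by linarith [abs_nonneg (y j)])]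
    exact div_le_one_of_le₀ (by linarith) (by linarith [abs_nonneg (y j)])
  · funext j
    induction j using Nat.strong_induction_on with
    | _ j ih =>
      rcases lt_or_ge j n with h | h
      · simp [schauderFill_of_lt _ h, h]
      · rw [schauderFill_of_le _ h, schauderSlope_congr ih]
        simp only [h.not_gt, if_false]
        refine div_mul_cancel_of_imp fun h0 => ?_
        exact abs_nonpos_iff.1 (by linarith [hb j])

theorem schauderFill_succ_update (n : ℕ) (x : ℕ → ℝ) :
    schauderFill (n + 1) (Function.update x n (x n * (1 - |schauderSlope x n|))) =
      schauderFill n x := by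
  funext j
  induction j using Nat.strong_induction_on with
  | _ j ih =>
    rcases lt_trichotomy j n with h | rfl | h
    · rw [schauderFill_of_lt _ (by omega), schauderFill_of_lt _ h, Function.update_of_ne h.ne]
    · rw [schauderFill_of_lt _ (by omega), schauderFill_of_le _ le_rfl, Function.update_self,
        schauderSlope_congr fun i hi => schauderFill_of_lt x hi]
    · rw [schauderFill_of_le _ (by omega), schauderFill_of_le _ h.le, Function.update_of_ne h.ne',
        schauderSlope_congr ih]

/-- Nonnegative functions of the first `n + 1` coordinates that are positively homogeneous and
vanish only at the origin. -/
structure IsRadialGauge (n : ℕ) (g : (ℕ → ℝ) → ℝ) : Prop where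
  nonneg : ∀ z, 0 ≤ g z
  eq_zero : ∀ z, g z = 0 → ∀ i ≤ n, z i = 0
  smul : ∀ (c : ℝ) (z z' : ℕ → ℝ), 0 ≤ c → (∀ i ≤ n, z' i = c * z i) → g z' = c * g z

/-- The radial map in the first `n + 1` coordinates that takes the unit ball of `a` to that of
`b`. -/
noncomputable def radialMap (n : ℕ) (a b : (ℕ → ℝ) → ℝ) (z : ℕ → ℝ) : ℕ → ℝ :=
  fun i => if i ≤ n then a z / b z * z i else z i

theorem radialMap_of_le {n i : ℕ} (a b : (ℕ → ℝ) → ℝ) (z : ℕ → ℝ) (h : i ≤ n) :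
    radialMap n a b z i = a z / b z * z i := if_pos h

theorem radialMap_of_lt {n i : ℕ} (a b : (ℕ → ℝ) → ℝ) (z : ℕ → ℝ) (h : n < i) :
    radialMap n a b z i = z i := if_neg h.not_ge

namespace IsRadialGauge

variable {n : ℕ} {a b : (ℕ → ℝ) → ℝ}

theorem congr (ha : IsRadialGauge n a) {z z' : ℕ → ℝ} (h : ∀ i ≤ n, z' i = z i) : a z' = a z := by
  simpa using ha.smul 1 z z' zero_le_one (by simpa using h)

theorem apply_eq_zero (ha : IsRadialGauge n a) {z : ℕ → ℝ} (h : ∀ i ≤ n, z i = 0) : a z = 0 := by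
  simpa using ha.smul 0 z z le_rfl (by simpa using h)

theorem apply_radialMap (ha : IsRadialGauge n a) (hb : IsRadialGauge n b) (z : ℕ → ℝ) :
    b (radialMap n a b z) = a z := by
  rw [hb.smul (a z / b z) z _ (div_nonneg (ha.nonneg z) (hb.nonneg z))
    fun i hi => radialMap_of_le a b z hi]
  exact div_mul_cancel_of_imp fun h => ha.apply_eq_zero (hb.eq_zero z h)

theorem radialMap_radialMap (ha : IsRadialGauge n a) (hb : IsRadialGauge n b) (z : ℕ → ℝ) :
    radialMap n b a (radialMap n a b z) = z := by
  funext i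
  rcases le_or_gt i n with hi | hi
  · rw [radialMap_of_le b a _ hi, ha.apply_radialMap hb, radialMap_of_le a b z hi,
      ha.smul (a z / b z) z _ (div_nonneg (ha.nonneg z) (hb.nonneg z))
      fun i hi => radialMap_of_le a b z hi]
    by_cases h : a z = 0
    · simp [ha.eq_zero z h i hi]
    · have hbz : b z ≠ 0 := fun h' => h (ha.apply_eq_zero (hb.eq_zero z h'))
      field_simp
  · rw [radialMap_of_lt b a _ hi, radialMap_of_lt a b z hi]

theorem continuous_radialMap (ha : IsRadialGauge n a) (hb : IsRadialGauge n b)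
    (hca : Continuous a) (hcb : Continuous b) (hab : ∀ z, a z ≤ b z) :
    Continuous (radialMap n a b) := by
  refine continuous_pi fun i => ?_
  rcases le_or_gt i n with hi | hi
  · simp only [radialMap_of_le a b _ hi]
    rw [continuous_iff_continuousAt]
    intro z
    by_cases h : b z = 0
    · have hz : z i = 0 := hb.eq_zero z h i hi
      have hlim : Tendsto (fun z' : ℕ → ℝ => |z' i|) (𝓝 z) (𝓝 0) := by
        have : Continuous fun z' : ℕ → ℝ => |z' i| := by fun_prop
        simpa [hz] using this.tendsto z
      rw [ContinuousAt, hz, mul_zero]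
      refine squeeze_zero_norm (fun z' => ?_) hlim
      rw [Real.norm_eq_abs, abs_mul, abs_of_nonneg (div_nonneg (ha.nonneg z') (hb.nonneg z'))]
      exact mul_le_of_le_one_left (abs_nonneg _) (div_le_one_of_le₀ (hab z') (hb.nonneg z'))
    · exact (hca.continuousAt.div hcb.continuousAt h).mul (continuous_apply i).continuousAt
  · simp only [radialMap_of_lt a b _ hi]
    fun_prop

theorem abs_radialMap_sub_le (hb : IsRadialGauge n b) {δ : ℝ} {z : ℕ → ℝ}
    (h₁ : (1 - δ) * b z ≤ a z) (h₂ : a z ≤ b z) {i : ℕ} (hδ : 0 ≤ δ) (hz : |z i| ≤ 1) :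
    |radialMap n a b z i - z i| ≤ δ := by
  rcases le_or_gt i n with hi | hi
  · rw [radialMap_of_le a b z hi]
    rcases (hb.nonneg z).eq_or_lt' with h | h
    · simpa [hb.eq_zero z h i hi] using hδ
    · have hc₁ : 1 - δ ≤ a z / b z := (le_div_iff₀ h).2 h₁
      have hc₂ : a z / b z ≤ 1 := (div_le_one h).2 h₂
      rw [← sub_one_mul, abs_mul]
      have : |a z / b z - 1| ≤ δ := abs_le.2 ⟨by linarith, by linarith⟩
      nlinarith [abs_nonneg (z i), abs_nonneg (a z / b z - 1)]
  · simpa [radialMap_of_lt a b z hi] using hδ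

end IsRadialGauge

/-- The analogue of `schauderGauge z (n + 1)` in which the constraint on the `n`-th coefficient is
relaxed by the factor `s` so as to be nowhere degenerate. -/
noncomputable def relaxedGauge (s : ℝ) (n : ℕ) (z : ℕ → ℝ) : ℝ :=
  max (schauderGauge z n) (s * |schauderSlope z n| + |z n|)

theorem relaxedGauge_one (n : ℕ) (z : ℕ → ℝ) : relaxedGauge 1 n z = schauderGauge z (n + 1) := by
  rw [relaxedGauge, one_mul, schauderGauge_succ]

theorem continuous_relaxedGauge (s : ℝ) (n : ℕ) : Continuous (relaxedGauge s n) := by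
  have h₁ := continuous_schauderGauge n
  have h₂ := continuous_schauderSlope n
  unfold relaxedGauge
  fun_prop

theorem isRadialGauge_relaxedGauge {s : ℝ} (hs : 0 ≤ s) (n : ℕ) :
    IsRadialGauge n (relaxedGauge s n) where
  nonneg z := (schauderGauge_nonneg z n).trans (le_max_left _ _)
  eq_zero z h i hi := by
    have h₁ : schauderGauge z n ≤ 0 := (le_max_left _ _).trans h.le
    have h₂ : s * |schauderSlope z n| + |z n| ≤ 0 := (le_max_right _ _).trans h.le
    have h₃ : 0 ≤ s * |schauderSlope z n| := mul_nonneg hs (abs_nonneg _)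
    rcases hi.eq_or_lt with rfl | hi
    · exact abs_nonpos_iff.1 (by linarith)
    · exact abs_nonpos_iff.1 ((abs_le_schauderGauge z hi).trans h₁)
  smul c z z' hc h := by
    rw [relaxedGauge, relaxedGauge, schauderGauge_of_eq_smul hc fun i hi => h i hi.le,
      schauderSlope_of_eq_smul fun i hi => h i hi.le, h n le_rfl, mul_max_of_nonneg _ _ hc,
      abs_mul, abs_mul, abs_of_nonneg hc]
    ring_nf

theorem relaxedGauge_le_relaxedGauge_one {s : ℝ} (hs : s ≤ 1) (n : ℕ) (z : ℕ → ℝ) :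
    relaxedGauge s n z ≤ relaxedGauge 1 n z :=
  max_le_max le_rfl
    (add_le_add (mul_le_mul_of_nonneg_right hs (abs_nonneg _)) le_rfl)

theorem mul_relaxedGauge_one_le {s : ℝ} (hs₀ : 0 ≤ s) (hs : s ≤ 1) (n : ℕ) (z : ℕ → ℝ) :
    s * relaxedGauge 1 n z ≤ relaxedGauge s n z := by
  rw [relaxedGauge, relaxedGauge, mul_max_of_nonneg _ _ hs₀]
  refine max_le_max (mul_le_of_le_one_left (schauderGauge_nonneg z n) hs) ?_
  nlinarith [mul_le_of_le_one_left (abs_nonneg (z n)) hs]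

/-- The homeomorphism from one stage to the next, close to the (non-injective) map that rescales
the `n`-th coordinate to the interval of admissible coefficients. -/
theorem exists_schauderStage_homeomorph (n : ℕ) {δ : ℝ} (hδ : 0 < δ) (hδ₁ : δ ≤ 1) :
    ∃ R : schauderStage n ≃ₜ schauderStage (n + 1),
      (∀ x : schauderStage n, ∀ i, |(R x : ℕ → ℝ) i -
        Function.update (x : ℕ → ℝ) n ((x : ℕ → ℝ) n * (1 - |schauderSlope x n|)) i| ≤ 2 * δ) ∧
      ∀ m > n, ∀ x x' : schauderStage n, (∀ i < m, (R x : ℕ → ℝ) i = (R x' : ℕ → ℝ) i) →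
        ∀ i < m, (x : ℕ → ℝ) i = (x' : ℕ → ℝ) i := by
  have hs₀ : 0 ≤ 1 - δ := by linarith
  have hs₁ : 1 - δ ≤ 1 := by linarith
  have ha := isRadialGauge_relaxedGauge hs₀ n
  have hb := isRadialGauge_relaxedGauge zero_le_one n
  set a := relaxedGauge (1 - δ) n
  set b := relaxedGauge 1 n
  let w : (ℕ → ℝ) → ℝ := fun x => 1 - (1 - δ) * |schauderSlope x n|
  have hw_pos : ∀ x, schauderGauge x n ≤ 1 → 0 < w x := by
    intro x hx
    have := mul_le_mul_of_nonneg_left ((abs_schauderSlope_le_gauge x n).trans hx) hs₀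
    simp only [w]
    linarith
  have hw_congr : ∀ x x' : ℕ → ℝ, (∀ i < n, x i = x' i) → w x = w x' := by
    intro x x' h
    simp only [w, schauderSlope_congr h]
  have hupd : ∀ (x : ℕ → ℝ) (t : ℝ), ∀ i < n, Function.update x n t i = x i :=
    fun x t i hi => Function.update_of_ne hi.ne _ _
  let T : (ℕ → ℝ) → ℕ → ℝ := fun x => Function.update x n (x n * w x)
  let T' : (ℕ → ℝ) → ℕ → ℝ := fun z => Function.update z n (z n / w z)
  have hT'T : ∀ x, schauderGauge x n ≤ 1 → T' (T x) = x := by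
    intro x hx
    simp only [T, T', hw_congr _ x (hupd x _), Function.update_idem, Function.update_self,
      mul_div_cancel_right₀ _ (hw_pos x hx).ne', Function.update_eq_self]
  have hTT' : ∀ x, schauderGauge x n ≤ 1 → T (T' x) = x := by
    intro x hx
    simp only [T, T', hw_congr _ x (hupd x _), Function.update_idem, Function.update_self,
      div_mul_cancel₀ _ (hw_pos x hx).ne', Function.update_eq_self]
  have hTa : ∀ x ∈ schauderStage n, a (T x) ≤ 1 := by
    intro x hx
    refine max_le ((schauderGauge_congr (hupd x _)).trans_le hx.1) ?_
    rw [schauderSlope_congr (hupd x _), show T x n = x n * w x from Function.update_self .., abs_mul,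
      abs_of_pos (hw_pos x hx.1)]
    have := mul_le_mul_of_nonneg_right (hx.2 n le_rfl) (hw_pos x hx.1).le
    simp only [w] at this ⊢
    linarith
  have hb_stage : ∀ z, b z = schauderGauge z (n + 1) := relaxedGauge_one n
  have hφ : ∀ x ∈ schauderStage n, radialMap n a b (T x) ∈ schauderStage (n + 1) := by
    intro x hx
    refine ⟨?_, fun j hj => ?_⟩
    · rw [← hb_stage, ha.apply_radialMap hb]
      exact hTa x hx
    · rw [radialMap_of_lt a b _ hj]
      simp only [T]
      rw [Function.update_of_ne (by omega)]
      exact hx.2 j (by omega)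
  have hψa : ∀ z ∈ schauderStage (n + 1), a (radialMap n b a z) ≤ 1 := by
    intro z hz
    rw [hb.apply_radialMap ha, hb_stage]
    exact hz.1
  have hψ : ∀ z ∈ schauderStage (n + 1), T' (radialMap n b a z) ∈ schauderStage n := by
    intro z hz
    have h₁ : schauderGauge (radialMap n b a z) n ≤ 1 := (le_max_left _ _).trans (hψa z hz)
    refine ⟨(schauderGauge_congr (hupd _ _)).trans_le h₁, fun j hj => ?_⟩
    rcases hj.eq_or_lt with rfl | hj
    · simp only [T', Function.update_self]
      rw [abs_div, abs_of_pos (hw_pos _ h₁)]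
      refine div_le_one_of_le₀ ?_ (hw_pos _ h₁).le
      have := (le_max_right _ _).trans (hψa z hz)
      simp only [w]
      linarith
    · simp only [T']
      rw [Function.update_of_ne (by omega), radialMap_of_lt b a z hj]
      exact hz.2 j hj
  let e : schauderStage n ≃ schauderStage (n + 1) :=
    { toFun := fun x => ⟨radialMap n a b (T x), hφ x x.2⟩
      invFun := fun z => ⟨T' (radialMap n b a z), hψ z z.2⟩
      left_inv := fun x => Subtype.ext <| by
        simp only [ha.radialMap_radialMap hb, hT'T _ x.2.1]
      right_inv := fun z => Subtype.ext <| by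
        have h₁ : schauderGauge (radialMap n b a z) n ≤ 1 := (le_max_left _ _).trans (hψa z z.2)
        simp only [hTT' _ h₁, hb.radialMap_radialMap ha] }
  have hTc : Continuous T := by
    have := continuous_schauderSlope n
    exact continuous_id.update n (by fun_prop)
  have hec : Continuous e := by
    refine Continuous.subtype_mk ?_ _
    exact (ha.continuous_radialMap hb (continuous_relaxedGauge _ n) (continuous_relaxedGauge _ n)
      (relaxedGauge_le_relaxedGauge_one hs₁ n)).comp (hTc.comp continuous_subtype_val)
  have : CompactSpace (schauderStage n) := isCompact_iff_compactSpace.1 (isCompact_schauderStage n)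
  refine ⟨Continuous.homeoOfEquivCompactToT2 (f := e) hec, ?_, ?_⟩
  · rintro ⟨x, hx⟩ i
    change |radialMap n a b (T x) i - Function.update x n (x n * (1 - |schauderSlope x n|)) i| ≤ _
    have hT₁ : ∀ i, |T x i| ≤ 1 := by
      intro i
      rcases lt_trichotomy i n with h | rfl | h
      · simpa only [T, Function.update_of_ne h.ne] using abs_le_one_of_mem_stage hx i
      · have := (le_max_right _ _).trans (hTa x hx)
        nlinarith [mul_nonneg hs₀ (abs_nonneg (schauderSlope (T x) i))]
      · simpa only [T, Function.update_of_ne h.ne'] using abs_le_one_of_mem_stage hx i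
    have h₁ := hb.abs_radialMap_sub_le (a := a) (mul_relaxedGauge_one_le hs₀ hs₁ n (T x))
      (relaxedGauge_le_relaxedGauge_one hs₁ n (T x)) hδ.le (hT₁ i)
    have h₂ : |T x i - Function.update x n (x n * (1 - |schauderSlope x n|)) i| ≤ δ := by
      rcases eq_or_ne i n with rfl | h
      · simp only [T, Function.update_self, w]
        rw [show x i * (1 - (1 - δ) * |schauderSlope x i|) - x i * (1 - |schauderSlope x i|) =
          δ * (x i * |schauderSlope x i|) by ring, abs_mul, abs_of_pos hδ, abs_mul, abs_abs]
        exact mul_le_of_le_one_right hδ.le (mul_le_one₀ (hx.2 i le_rfl) (abs_nonneg _)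
          ((abs_schauderSlope_le_gauge x i).trans hx.1))
      · simpa only [T, Function.update_of_ne h, sub_self, abs_zero] using hδ.le
    linarith [abs_sub_le (radialMap n a b (T x) i) (T x i)
      (Function.update x n (x n * (1 - |schauderSlope x n|)) i)]
  · intro m hm x x' h i hi
    have key : ∀ z z' : ℕ → ℝ, (∀ i < m, z i = z' i) →
        ∀ i < m, T' (radialMap n b a z) i = T' (radialMap n b a z') i := by
      intro z z' h
      have hr : ∀ i < m, radialMap n b a z i = radialMap n b a z' i := by
        intro i hi
        rcases le_or_gt i n with hin | hin
        · rw [radialMap_of_le b a z hin, radialMap_of_le b a z' hin, h i hi,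
            ha.congr fun i hi => h i (by omega), hb.congr fun i hi => h i (by omega)]
        · rw [radialMap_of_lt b a z hin, radialMap_of_lt b a z' hin, h i hi]
      intro i hi
      simp only [T', hw_congr _ _ fun i hi => hr i (by omega), hr n hm]
      rcases eq_or_ne i n with rfl | hin
      · simp
      · rw [Function.update_of_ne hin, Function.update_of_ne hin, hr i hi]
    have hx := congrArg Subtype.val (e.symm_apply_apply x)
    have hx' := congrArg Subtype.val (e.symm_apply_apply x')
    rw [← hx, ← hx']
    exact key _ _ h i hi

/-- Finitely many stages can be passed while changing the resulting sequence arbitrarily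
little. -/
theorem exists_schauderStage_homeomorph_fill_near {n m : ℕ} (hnm : n ≤ m)
    {U : Set ((ℕ → ℝ) × (ℕ → ℝ))} (hU : U ∈ 𝓤 (ℕ → ℝ)) :
    ∃ R : schauderStage n ≃ₜ schauderStage m,
      (∀ x : schauderStage n, (schauderFill n x, schauderFill m (R x)) ∈ U) ∧
      ∀ k ≥ m, ∀ x x' : schauderStage n, (∀ i < k, (R x : ℕ → ℝ) i = (R x' : ℕ → ℝ) i) →
        ∀ i < k, (x : ℕ → ℝ) i = (x' : ℕ → ℝ) i := by
  induction m, hnm using Nat.le_induction generalizing U with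
  | base => exact ⟨Homeomorph.refl _, fun x => refl_mem_uniformity hU, fun k _ x x' h => h⟩
  | succ m hnm ih =>
    obtain ⟨W, hW, hWU⟩ := comp_mem_uniformity_sets hU
    obtain ⟨R, hR, hR'⟩ := ih hW
    have hbox : IsCompact {x : ℕ → ℝ | ∀ j, |x j| ≤ 1} := by
      refine isCompact_of_isClosed_of_abs_le_one ?_ fun x hx => hx
      simp only [ofPred_forall]
      exact isClosed_iInter fun j => isClosed_le (by fun_prop) continuous_const
    have huc := hbox.uniformContinuousOn_of_continuous
      (continuous_schauderFill (m + 1)).continuousOn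
    have hmem := huc hW
    rw [mem_map, mem_inf_principal] at hmem
    obtain ⟨l, ε, hε, hl⟩ := exists_forall_lt_of_mem_uniformity_pi hmem
    obtain ⟨P, hP, hP'⟩ := exists_schauderStage_homeomorph m (δ := min (ε / 3) 1)
      (by positivity) (min_le_right _ _)
    refine ⟨R.trans P, fun x => hWU ⟨_, hR x, ?_⟩, fun k hk x x' h =>
      hR' k (by omega) x x' (hP' k (by omega) _ _ h)⟩
    set z := R x
    rw [← schauderFill_succ_update m z]
    have hp : ∀ j, |Function.update (z : ℕ → ℝ) m ((z : ℕ → ℝ) m * (1 - |schauderSlope z m|)) j|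
        ≤ 1 := by
      intro j
      rcases eq_or_ne j m with rfl | hj
      · have h₁ := (abs_schauderSlope_le_gauge z j).trans z.2.1
        rw [Function.update_self, abs_mul, abs_of_nonneg (sub_nonneg.2 h₁)]
        exact mul_le_one₀ (z.2.2 j le_rfl) (sub_nonneg.2 h₁)
          (by linarith [abs_nonneg (schauderSlope z j)])
      · rw [Function.update_of_ne hj]
        exact abs_le_one_of_mem_stage z.2 j
    refine hl _ _ (fun i _ => ?_) ⟨hp, abs_le_one_of_mem_stage (P z).2⟩
    rw [abs_sub_comm]
    exact (hP z i).trans_lt (by linarith [min_le_left (ε / 3) 1])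

theorem nonempty_schauderStage_zero_homeomorph_schauderSet :
    Nonempty (schauderStage 0 ≃ₜ schauderSet) := by
  have hcs : ∀ n, CompactSpace (schauderStage n) := fun n =>
    isCompact_iff_compactSpace.1 (isCompact_schauderStage n)
  have : CompactSpace schauderSet := isCompact_iff_compactSpace.1 isCompact_schauderSet
  refine nonempty_homeomorph_of_approx
    {g : C(schauderStage 0, schauderSet) | ∃ n, ∃ h : schauderStage 0 ≃ₜ schauderStage n,
      ∀ x, (g x : ℕ → ℝ) = schauderFill n (h x)} ?_ ?_ ?_
  · exact ⟨⟨fun x => ⟨schauderFill 0 x, schauderFill_mem x.2⟩,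
      ((continuous_schauderFill 0).comp continuous_subtype_val).subtype_mk _⟩, 0,
      Homeomorph.refl _, fun x => rfl⟩
  · rintro g ⟨n, h, hg⟩ ⟨y, hy⟩
    obtain ⟨x, hx, hxy⟩ := exists_schauderFill_eq n hy
    exact ⟨h.symm ⟨x, hx⟩, Subtype.ext (by rw [hg, h.apply_symm_apply, hxy])⟩
  · rintro g ⟨n, h, hg⟩ U hU V hV
    rw [uniformity_subtype, mem_comap] at hU
    obtain ⟨U', hU', hUU'⟩ := hU
    have hsymm := CompactSpace.uniformContinuous_of_continuous h.symm.continuous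
    have hV₁ := hsymm hV
    rw [uniformity_subtype, mem_map, mem_comap] at hV₁
    obtain ⟨V', hV', hVV'⟩ := hV₁
    obtain ⟨l, ε, hε, hl⟩ := exists_forall_lt_of_mem_uniformity_pi hV'
    obtain ⟨R, hR, hR'⟩ := exists_schauderStage_homeomorph_fill_near (le_max_left n l) hU'
    refine ⟨⟨fun x => ⟨schauderFill (max n l) (R (h x)), schauderFill_mem (R (h x)).2⟩,
      ((continuous_schauderFill _).comp (continuous_subtype_val.comp
        (R.continuous.comp h.continuous))).subtype_mk _⟩,
      ⟨max n l, h.trans R, fun x => rfl⟩, fun x => hUU' ?_, fun x x' hxx => ?_⟩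
    · change ((g x : ℕ → ℝ), _) ∈ U'
      rw [hg]
      exact hR (h x)
    · have hfill : schauderFill (max n l) (R (h x)) = schauderFill (max n l) (R (h x')) :=
        congrArg Subtype.val hxx
      have hagree := hR' (max n l) le_rfl (h x) (h x') fun i hi => by
        simpa only [schauderFill_of_lt _ hi] using congrFun hfill i
      have hmem : (h x, h x') ∈ (fun p : schauderStage n × schauderStage n =>
          (h.symm p.1, h.symm p.2)) ⁻¹' V := hVV' <| hl _ _ fun i hi => by
        rw [hagree i (lt_max_of_lt_right hi), sub_self, abs_zero]
        exact hε
      simpa using hmem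

theorem nonempty_hilbertCube_homeomorph_schauderSet :
    Nonempty ((ℕ → Icc (0 : ℝ) 1) ≃ₜ schauderSet) := by
  obtain ⟨e⟩ := nonempty_schauderStage_zero_homeomorph_schauderSet
  have hmem : ∀ x : ℕ → ℝ, x ∈ schauderStage 0 ↔ ∀ j, x j ∈ Icc (-1 : ℝ) 1 := fun x => by
    simp [schauderStage, schauderGauge, abs_le]
  let φ : (ℕ → Icc (0 : ℝ) 1) ≃ₜ schauderStage 0 :=
    { toFun := fun x => ⟨fun j => 2 * x j - 1, (hmem _).2 fun j =>
        ⟨by linarith [(x j).2.1], by linarith [(x j).2.2]⟩⟩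
      invFun := fun z j => ⟨((z : ℕ → ℝ) j + 1) / 2,
        by linarith [((hmem z).1 z.2 j).1], by linarith [((hmem z).1 z.2 j).2]⟩
      left_inv := fun x => by ext j; simp
      right_inv := fun z => by ext j; simp; ring
      continuous_toFun := by fun_prop
      continuous_invFun := continuous_pi fun j => Continuous.subtype_mk
        ((((continuous_apply j).comp continuous_subtype_val).add_const 1).div_const 2) _ }
  exact ⟨φ.trans e⟩

/-- The length of the `n`-th dyadic subinterval of `[0, π]`. -/
noncomputable def dyadicWidth : ℕ → ℝ
  | 0 => Real.pi
  | 1 => Real.pi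
  | n + 2 => dyadicWidth ((n + 2) / 2) / 2
decreasing_by omega

/-- The left endpoint of the `n`-th dyadic subinterval of `[0, π]`. -/
noncomputable def dyadicLeft : ℕ → ℝ
  | 0 => 0
  | 1 => 0
  | n + 2 => dyadicLeft ((n + 2) / 2) + ((n + 2) % 2 : ℕ) * (dyadicWidth ((n + 2) / 2) / 2)
decreasing_by omega

theorem dyadicWidth_one : dyadicWidth 1 = Real.pi := by rw [dyadicWidth]

theorem dyadicLeft_one : dyadicLeft 1 = 0 := by rw [dyadicLeft]

theorem dyadicWidth_two_mul {n : ℕ} (hn : 1 ≤ n) : dyadicWidth (2 * n) = dyadicWidth n / 2 := by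
  obtain ⟨k, rfl⟩ := Nat.exists_eq_add_of_le' hn
  rw [show 2 * (k + 1) = 2 * k + 2 by ring, dyadicWidth, show (2 * k + 2) / 2 = k + 1 by omega]

theorem dyadicWidth_two_mul_add_one {n : ℕ} (hn : 1 ≤ n) :
    dyadicWidth (2 * n + 1) = dyadicWidth n / 2 := by
  obtain ⟨k, rfl⟩ := Nat.exists_eq_add_of_le' hn
  rw [show 2 * (k + 1) + 1 = 2 * k + 1 + 2 by ring, dyadicWidth,
    show (2 * k + 1 + 2) / 2 = k + 1 by omega]

theorem dyadicLeft_two_mul {n : ℕ} (hn : 1 ≤ n) : dyadicLeft (2 * n) = dyadicLeft n := by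
  obtain ⟨k, rfl⟩ := Nat.exists_eq_add_of_le' hn
  rw [show 2 * (k + 1) = 2 * k + 2 by ring, dyadicLeft, show (2 * k + 2) / 2 = k + 1 by omega,
    show (2 * k + 2) % 2 = 0 by omega]
  simp

theorem dyadicLeft_two_mul_add_one {n : ℕ} (hn : 1 ≤ n) :
    dyadicLeft (2 * n + 1) = dyadicLeft n + dyadicWidth n / 2 := by
  obtain ⟨k, rfl⟩ := Nat.exists_eq_add_of_le' hn
  rw [show 2 * (k + 1) + 1 = 2 * k + 1 + 2 by ring, dyadicLeft,
    show (2 * k + 1 + 2) / 2 = k + 1 by omega, show (2 * k + 1 + 2) % 2 = 1 by omega]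
  simp

/-- Induction along the binary tree whose root is `1`. -/
theorem dyadic_induction {p : (n : ℕ) → 1 ≤ n → Prop} (one : p 1 le_rfl)
    (left : ∀ n hn, p n hn → p (2 * n) (by omega))
    (right : ∀ n hn, p n hn → p (2 * n + 1) (by omega)) (n : ℕ) (hn : 1 ≤ n) : p n hn := by
  induction n using Nat.strong_induction_on with
  | _ n ih =>
    obtain ⟨k, rfl | rfl⟩ := Nat.even_or_odd' n
    · exact left k (by omega) (ih k (by omega) (by omega))
    · rcases Nat.eq_zero_or_pos k with rfl | hk
      · exact one
      · exact right k hk (ih k (by omega) hk)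

theorem dyadicWidth_pos {n : ℕ} (hn : 1 ≤ n) : 0 < dyadicWidth n := by
  induction n, hn using dyadic_induction with
  | one => rw [dyadicWidth_one]; exact Real.pi_pos
  | left n hn ih => rw [dyadicWidth_two_mul hn]; linarith
  | right n hn ih => rw [dyadicWidth_two_mul_add_one hn]; linarith

theorem dyadic_subinterval {m n e : ℕ} (hn : 1 ≤ n) (h : m / 2 ^ e = n) :
    dyadicLeft n ≤ dyadicLeft m ∧
      dyadicLeft m + dyadicWidth m ≤ dyadicLeft n + dyadicWidth n := by
  induction e generalizing m with
  | zero => simp only [pow_zero, Nat.div_one] at h; simp [h]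
  | succ e ih =>
    rw [pow_succ', ← Nat.div_div_eq_div_mul] at h
    obtain ⟨h₁, h₂⟩ := ih h
    have hm : 1 ≤ m / 2 := by
      rw [Nat.one_le_iff_ne_zero]
      intro h0
      rw [h0, Nat.zero_div] at h
      omega
    have hw := dyadicWidth_pos hm
    obtain ⟨k, hk | hk⟩ := Nat.even_or_odd' m
    · have hk' : m / 2 = k := by omega
      rw [hk'] at h₁ h₂ hm hw
      rw [hk, dyadicLeft_two_mul hm, dyadicWidth_two_mul hm]
      exact ⟨h₁, by linarith⟩
    · have hk' : m / 2 = k := by omega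
      rw [hk'] at h₁ h₂ hm hw
      rw [hk, dyadicLeft_two_mul_add_one hm, dyadicWidth_two_mul_add_one hm]
      exact ⟨by linarith, by linarith⟩

theorem exists_div_two_pow_eq_one {m : ℕ} (hm : 1 ≤ m) : ∃ e ≤ m, m / 2 ^ e = 1 := by
  induction m using Nat.strong_induction_on with
  | _ m ih =>
    rcases hm.eq_or_lt with rfl | hm
    · exact ⟨0, by simp⟩
    · obtain ⟨e, he, h⟩ := ih (m / 2) (by omega) (by omega)
      exact ⟨e + 1, by omega, by rw [pow_succ', ← Nat.div_div_eq_div_mul, h]⟩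

theorem dyadicLeft_mem {n : ℕ} (hn : 1 ≤ n) : dyadicLeft n ∈ Icc 0 Real.pi := by
  obtain ⟨e, -, h⟩ := exists_div_two_pow_eq_one hn
  have := dyadic_subinterval le_rfl h
  rw [dyadicLeft_one, dyadicWidth_one] at this
  exact ⟨this.1, by linarith [dyadicWidth_pos hn]⟩

theorem dyadicRight_mem {n : ℕ} (hn : 1 ≤ n) : dyadicLeft n + dyadicWidth n ∈ Icc 0 Real.pi := by
  obtain ⟨e, -, h⟩ := exists_div_two_pow_eq_one hn
  have := dyadic_subinterval le_rfl h
  rw [dyadicLeft_one, dyadicWidth_one] at this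
  exact ⟨by linarith [dyadicWidth_pos hn], by linarith⟩

theorem exists_mem_dyadic {t : ℝ} (ht : t ∈ Icc 0 Real.pi) (k : ℕ) :
    ∃ n ≥ 1, dyadicWidth n = Real.pi / 2 ^ k ∧
      t ∈ Icc (dyadicLeft n) (dyadicLeft n + dyadicWidth n) := by
  induction k with
  | zero => exact ⟨1, le_rfl, by simp [dyadicWidth_one], by simpa [dyadicWidth_one, dyadicLeft_one]⟩
  | succ k ih =>
    obtain ⟨n, hn, hw, h₁, h₂⟩ := ih
    rcases le_total t (dyadicLeft n + dyadicWidth n / 2) with h | h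
    · refine ⟨2 * n, by omega, ?_, ?_⟩
      · rw [dyadicWidth_two_mul hn, hw, pow_succ]; ring
      · rw [dyadicWidth_two_mul hn, dyadicLeft_two_mul hn]
        exact ⟨h₁, h⟩
    · refine ⟨2 * n + 1, by omega, ?_, ?_⟩
      · rw [dyadicWidth_two_mul_add_one hn, hw, pow_succ]; ring
      · rw [dyadicWidth_two_mul_add_one hn, dyadicLeft_two_mul_add_one hn]
        exact ⟨h, by linarith⟩

theorem schauderSlope_two_mul (y : ℕ → ℝ) {n : ℕ} (hn : 1 ≤ n) :
    schauderSlope y (2 * n) = schauderSlope y n + y n := by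
  obtain ⟨k, rfl⟩ := Nat.exists_eq_add_of_le' hn
  rw [show 2 * (k + 1) = 2 * k + 1 + 1 by ring, schauderSlope_succ,
    show (2 * k + 1 + 1) / 2 = k + 1 by omega, Even.neg_one_pow ⟨k + 1, by ring⟩, one_mul]

theorem schauderSlope_two_mul_add_one (y : ℕ → ℝ) (n : ℕ) :
    schauderSlope y (2 * n + 1) = schauderSlope y n - y n := by
  rw [schauderSlope_succ, show (2 * n + 1) / 2 = n by omega, Odd.neg_one_pow ⟨n, rfl⟩]
  ring

/-- The slope of the chord of `F` over the `n`-th dyadic interval. -/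
noncomputable def dyadicSlope (F : ℝ → ℝ) (n : ℕ) : ℝ :=
  (F (dyadicLeft n + dyadicWidth n) - F (dyadicLeft n)) / dyadicWidth n

/-- The Faber–Schauder coefficients of `F`. -/
noncomputable def schauderCoeff (F : ℝ → ℝ) (n : ℕ) : ℝ :=
  if n = 0 then -dyadicSlope F 1 else (dyadicSlope F (2 * n) - dyadicSlope F (2 * n + 1)) / 2

theorem dyadicSlope_eq_average (F : ℝ → ℝ) {n : ℕ} (hn : 1 ≤ n) :
    dyadicSlope F n = (dyadicSlope F (2 * n) + dyadicSlope F (2 * n + 1)) / 2 := by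
  have hw := dyadicWidth_pos hn
  rw [dyadicSlope, dyadicSlope, dyadicSlope, dyadicWidth_two_mul hn, dyadicLeft_two_mul hn,
    dyadicWidth_two_mul_add_one hn, dyadicLeft_two_mul_add_one hn, add_assoc, add_halves]
  field_simp
  ring

theorem schauderSlope_schauderCoeff (F : ℝ → ℝ) {n : ℕ} (hn : 1 ≤ n) :
    schauderSlope (schauderCoeff F) n = dyadicSlope F n := by
  induction n, hn using dyadic_induction with
  | one =>
    have := schauderSlope_two_mul_add_one (schauderCoeff F) 0
    simpa [schauderSlope_zero, schauderCoeff] using this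
  | left n hn ih =>
    rw [schauderSlope_two_mul _ hn, ih, schauderCoeff, if_neg (by omega),
      dyadicSlope_eq_average F hn]
    ring
  | right n hn ih =>
    rw [schauderSlope_two_mul_add_one _, ih, schauderCoeff, if_neg (by omega),
      dyadicSlope_eq_average F hn]
    ring

theorem abs_dyadicSlope_le_one {F : ℝ → ℝ} (hF : LipschitzWith 1 F) {n : ℕ} (hn : 1 ≤ n) :
    |dyadicSlope F n| ≤ 1 := by
  have hw := dyadicWidth_pos hn
  have := hF.dist_le_mul (dyadicLeft n + dyadicWidth n) (dyadicLeft n)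
  rw [Real.dist_eq, Real.dist_eq, add_sub_cancel_left, abs_of_pos hw, NNReal.coe_one, one_mul]
    at this
  rw [dyadicSlope, abs_div, abs_of_pos hw]
  exact div_le_one_of_le₀ this hw.le

theorem schauderCoeff_mem {F : ℝ → ℝ} (hF : LipschitzWith 1 F) :
    schauderCoeff F ∈ schauderSet := by
  intro n
  induction n with
  | zero => simp [schauderGauge]
  | succ n ih =>
    refine max_le ih ?_
    rcases Nat.eq_zero_or_pos n with rfl | hn
    · simpa [schauderSlope_zero, schauderCoeff] using abs_dyadicSlope_le_one hF le_rfl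
    · rw [schauderSlope_schauderCoeff F hn, schauderCoeff, if_neg hn.ne',
        dyadicSlope_eq_average F hn]
      have h₁ := abs_le.1 (abs_dyadicSlope_le_one hF (n := 2 * n) (by omega))
      have h₂ := abs_le.1 (abs_dyadicSlope_le_one hF (n := 2 * n + 1) (by omega))
      rcases abs_cases ((dyadicSlope F (2 * n) + dyadicSlope F (2 * n + 1)) / 2) with h | h <;>
      rcases abs_cases ((dyadicSlope F (2 * n) - dyadicSlope F (2 * n + 1)) / 2) with h' | h' <;>
      linarith

theorem schauderCoeff_congr_of_sub_const {F G : ℝ → ℝ} {c : ℝ}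
    (h : ∀ t ∈ Icc 0 Real.pi, G t = F t - c) : schauderCoeff G = schauderCoeff F := by
  have hs : ∀ n ≥ 1, dyadicSlope G n = dyadicSlope F n := fun n hn => by
    rw [dyadicSlope, dyadicSlope, h _ (dyadicLeft_mem hn), h _ (dyadicRight_mem hn),
      sub_sub_sub_cancel_right]
  funext n
  rw [schauderCoeff, schauderCoeff]
  split_ifs with hn
  · rw [hs 1 le_rfl]
  · rw [hs _ (by omega), hs _ (by omega)]

theorem sub_eq_of_schauderCoeff_eq {F G : ℝ → ℝ} (hF : LipschitzWith 1 F) (hG : LipschitzWith 1 G)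
    (h : schauderCoeff F = schauderCoeff G) {t : ℝ} (ht : t ∈ Icc 0 Real.pi) :
    F t - G t = F 0 - G 0 := by
  have hs : ∀ n ≥ 1, F (dyadicLeft n + dyadicWidth n) - G (dyadicLeft n + dyadicWidth n) =
      F (dyadicLeft n) - G (dyadicLeft n) := by
    intro n hn
    have : dyadicSlope F n = dyadicSlope G n := by
      rw [← schauderSlope_schauderCoeff F hn, h, schauderSlope_schauderCoeff G hn]
    rw [dyadicSlope, dyadicSlope, div_left_inj' (dyadicWidth_pos hn).ne'] at this
    linarith
  have hl : ∀ n, 1 ≤ n → F (dyadicLeft n) - G (dyadicLeft n) = F 0 - G 0 := by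
    intro n hn
    induction n, hn using dyadic_induction with
    | one => rw [dyadicLeft_one]
    | left n hn ih => rwa [dyadicLeft_two_mul hn]
    | right n hn ih =>
      rw [dyadicLeft_two_mul_add_one hn, ← dyadicLeft_two_mul hn, ← dyadicWidth_two_mul hn,
        hs _ (by omega), dyadicLeft_two_mul hn, ih]
  have hbound : ∀ k : ℕ, |F t - G t - (F 0 - G 0)| ≤ 2 * (Real.pi / 2 ^ k) := by
    intro k
    obtain ⟨n, hn, hw, h₁, h₂⟩ := exists_mem_dyadic ht k
    have hF' := hF.dist_le_mul t (dyadicLeft n)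
    have hG' := hG.dist_le_mul t (dyadicLeft n)
    rw [Real.dist_eq, Real.dist_eq, NNReal.coe_one, one_mul,
      abs_of_nonneg (a := t - _) (by linarith)] at hF' hG'
    rw [← hl n hn, ← hw]
    rw [abs_le] at hF' hG' ⊢
    constructor <;> linarith [hF'.1, hF'.2, hG'.1, hG'.2]
  have hlim : Tendsto (fun k : ℕ => 2 * (Real.pi / 2 ^ k)) atTop (𝓝 0) := by
    have := (tendsto_pow_atTop_nhds_zero_of_lt_one (r := (1 / 2 : ℝ)) (by norm_num)
      (by norm_num)).const_mul (2 * Real.pi)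
    rw [mul_zero] at this
    refine this.congr fun k => ?_
    rw [div_pow, one_pow]
    ring
  exact sub_eq_zero.1 (abs_nonpos_iff.1 (ge_of_tendsto' hlim hbound))

theorem abs_min_sub_min_add_abs_max_sub_max (a b c : ℝ) :
    |min a c - min b c| + |max a c - max b c| = |a - b| := by
  rcases le_total a c with h | h <;> rcases le_total b c with h' | h' <;> simp only [h, h',
    min_eq_left, min_eq_right, max_eq_left, max_eq_right, sub_self, abs_zero, add_zero, zero_add]
  · rw [abs_of_nonpos, abs_of_nonpos, abs_of_nonpos] <;> linarith
  · rw [abs_of_nonneg, abs_of_nonneg, abs_of_nonneg] <;> linarith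

theorem exists_lipschitz_of_mem_schauderSet {y : ℕ → ℝ} (hy : y ∈ schauderSet) (d : ℕ) {n : ℕ}
    (hn : 1 ≤ n) : ∃ F : ℝ → ℝ, LipschitzWith 1 F ∧ ∀ e ≤ d, ∀ m, m / 2 ^ e = n →
      F (dyadicLeft m + dyadicWidth m) - F (dyadicLeft m) =
        dyadicWidth m * schauderSlope y m := by
  induction d generalizing n with
  | zero =>
    refine ⟨fun t => schauderSlope y n * t, LipschitzWith.of_dist_le_mul fun a b => ?_, ?_⟩
    · rw [Real.dist_eq, Real.dist_eq, ← mul_sub, abs_mul]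
      exact mul_le_mul_of_nonneg_right ((abs_schauderSlope_le_gauge y n).trans (hy n))
        (abs_nonneg _)
    · intro e he m hm
      obtain rfl : e = 0 := by omega
      simp only [pow_zero, Nat.div_one] at hm
      rw [hm]
      ring
  | succ d ih =>
    obtain ⟨F, hF, hF'⟩ := ih (n := 2 * n) (by omega)
    obtain ⟨G, hG, hG'⟩ := ih (n := 2 * n + 1) (by omega)
    have hw := dyadicWidth_pos hn
    set c := dyadicLeft n + dyadicWidth n / 2 with hc
    refine ⟨fun t => F (min t c) + G (max t c), LipschitzWith.of_dist_le_mul fun a b => ?_, ?_⟩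
    · have h₁ := hF.dist_le_mul (min a c) (min b c)
      have h₂ := hG.dist_le_mul (max a c) (max b c)
      rw [NNReal.coe_one, one_mul] at *
      refine (dist_add_add_le _ _ _ _).trans ((add_le_add h₁ h₂).trans_eq ?_)
      exact abs_min_sub_min_add_abs_max_sub_max a b c
    · intro e he m hm
      cases e with
      | zero =>
        simp only [pow_zero, Nat.div_one] at hm
        subst hm
        have h₁ := hF' 0 (Nat.zero_le _) (2 * m) (by simp)
        have h₂ := hG' 0 (Nat.zero_le _) (2 * m + 1) (by simp)
        rw [dyadicLeft_two_mul hn, dyadicWidth_two_mul hn, schauderSlope_two_mul y hn, ← hc] at h₁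
        rw [dyadicLeft_two_mul_add_one hn, dyadicWidth_two_mul_add_one hn,
          schauderSlope_two_mul_add_one y, add_assoc, add_halves, ← hc] at h₂
        simp only
        rw [min_eq_right (by linarith), max_eq_left (by linarith), min_eq_left (by linarith),
          max_eq_right (by linarith)]
        linarith
      | succ e =>
        have hm' : m / 2 ^ e / 2 = n := by rw [Nat.div_div_eq_div_mul, ← pow_succ, hm]
        have hm₁ : 1 ≤ m := by
          rw [Nat.one_le_iff_ne_zero]
          rintro rfl
          rw [Nat.zero_div] at hm
          omega
        have hwm := dyadicWidth_pos hm₁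
        rcases (by omega : m / 2 ^ e = 2 * n ∨ m / 2 ^ e = 2 * n + 1) with h | h
        · obtain ⟨h₁, h₂⟩ := dyadic_subinterval (by omega) h
          rw [dyadicLeft_two_mul hn, dyadicWidth_two_mul hn, ← hc] at h₂
          simp only
          rw [min_eq_left h₂, max_eq_right h₂, min_eq_left (by linarith),
            max_eq_right (by linarith), add_sub_add_right_eq_sub]
          exact hF' e (by omega) m h
        · obtain ⟨h₁, h₂⟩ := dyadic_subinterval (by omega) h
          rw [dyadicLeft_two_mul_add_one hn, ← hc] at h₁
          simp only
          rw [min_eq_right h₁, max_eq_left h₁, min_eq_right (by linarith),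
            max_eq_left (by linarith), add_sub_add_left_eq_sub]
          exact hG' e (by omega) m h

theorem exists_lipschitz_schauderCoeff_eq {y : ℕ → ℝ} (hy : y ∈ schauderSet) (d : ℕ) :
    ∃ F : ℝ → ℝ, LipschitzWith 1 F ∧ ∀ n < d, schauderCoeff F n = y n := by
  obtain ⟨F, hF, h⟩ := exists_lipschitz_of_mem_schauderSet hy (2 * d) le_rfl
  refine ⟨F, hF, fun n hn => ?_⟩
  have hs : ∀ m, 1 ≤ m → m ≤ 2 * d → dyadicSlope F m = schauderSlope y m := by
    intro m hm hmd
    obtain ⟨e, he, hem⟩ := exists_div_two_pow_eq_one hm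
    rw [dyadicSlope, h e (by omega) m hem, mul_div_cancel_left₀ _ (dyadicWidth_pos hm).ne']
  rw [schauderCoeff]
  split_ifs with h0
  · rw [hs 1 le_rfl (by omega), h0]
    have := schauderSlope_two_mul_add_one y 0
    rw [mul_zero, zero_add, schauderSlope_zero] at this
    rw [this]
    ring
  · rw [hs _ (by omega) (by omega), hs _ (by omega) (by omega),
      schauderSlope_two_mul y (by omega), schauderSlope_two_mul_add_one y]
    ring

theorem isCompact_FS1c : IsCompact FS1c := by
  have hnear : ∀ f ∈ FS1c, ∀ x, f x ∈ Icc (-Real.pi) (2 * Real.pi) := by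
    rintro f ⟨hf, hsum⟩ x
    have h₀ := hf.dist_le_mul x ⟨0, Set.left_mem_Icc.2 Real.pi_pos.le⟩
    have h₁ := hf.dist_le_mul x ⟨Real.pi, Set.right_mem_Icc.2 Real.pi_pos.le⟩
    obtain ⟨x, hx₀, hx₁⟩ := x
    rw [NNReal.coe_one, one_mul, Subtype.dist_eq, Real.dist_eq, Real.dist_eq] at h₀ h₁
    rw [abs_of_nonneg (a := x - 0) (by linarith)] at h₀
    rw [abs_of_nonpos (a := x - Real.pi) (by linarith)] at h₁
    rw [abs_le] at h₀ h₁
    constructor <;> linarith [h₀.1, h₀.2, h₁.1, h₁.2, Real.pi_pos]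
  refine ArzelaAscoli.isCompact_of_equicontinuous _ ?_
    (LipschitzWith.uniformEquicontinuous _ 1 fun f => f.2.1).equicontinuous
  have himage : ContinuousMap.toFun '' FS1c = {g | LipschitzWith 1 g ∧
      g ⟨0, Set.left_mem_Icc.2 Real.pi_pos.le⟩ +
        g ⟨Real.pi, Set.right_mem_Icc.2 Real.pi_pos.le⟩ = Real.pi} := by
    ext g
    constructor
    · rintro ⟨f, hf, rfl⟩
      exact hf
    · exact fun hg => ⟨⟨g, hg.1.continuous⟩, hg, rfl⟩
  refine (isCompact_univ_pi fun _ => isCompact_Icc (a := -Real.pi) (b := 2 * Real.pi)).of_isClosed_subset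
    ?_ ?_
  · rw [himage]
    refine IsClosed.inter ?_ (isClosed_eq (by fun_prop) continuous_const)
    exact isClosed_setOfPred_lipschitzWith 1
  · rintro _ ⟨f, hf, rfl⟩ x -
    exact hnear f hf x

theorem continuous_schauderCoeff_IccExtend (n : ℕ) : Continuous fun f : FS1c =>
    schauderCoeff (IccExtend Real.pi_pos.le (f : C(Icc (0 : ℝ) Real.pi, ℝ))) n := by
  have heval : ∀ t, Continuous fun f : FS1c =>
      IccExtend Real.pi_pos.le (f : C(Icc (0 : ℝ) Real.pi, ℝ)) t := fun t =>
    (continuous_eval_const (projIcc 0 Real.pi Real.pi_pos.le t)).comp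
      continuous_subtype_val
  have hslope : ∀ m, Continuous fun f : FS1c =>
      dyadicSlope (IccExtend Real.pi_pos.le (f : C(Icc (0 : ℝ) Real.pi, ℝ))) m := fun m =>
    ((heval _).sub (heval _)).div_const _
  unfold schauderCoeff
  split_ifs
  · exact (hslope _).neg
  · exact ((hslope _).sub (hslope _)).div_const _

theorem lipschitzWith_IccExtend {f : C(Icc (0 : ℝ) Real.pi, ℝ)} (hf : f ∈ FS1c) :
    LipschitzWith 1 (IccExtend Real.pi_pos.le f) := by
  rw [← mul_one (1 : NNReal)]
  exact hf.1.comp (LipschitzWith.projIcc Real.pi_pos.le)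

/-- The restriction of a `1`-Lipschitz function, shifted by a constant, belongs to `FS1c`. -/
theorem exists_mem_FS1c_schauderCoeff_eq {F : ℝ → ℝ} (hF : LipschitzWith 1 F) :
    ∃ f ∈ FS1c, schauderCoeff (IccExtend Real.pi_pos.le f) = schauderCoeff F := by
  set c := (F 0 + F Real.pi - Real.pi) / 2 with hc
  have hL : LipschitzWith 1 fun t : Icc (0 : ℝ) Real.pi => F t - c :=
    LipschitzWith.of_dist_le_mul fun a b => by
      rw [dist_sub_right]
      exact hF.dist_le_mul a b
  refine ⟨⟨_, hL.continuous⟩, ⟨hL, ?_⟩, schauderCoeff_congr_of_sub_const (c := c) fun t ht => ?_⟩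
  · simp only [ContinuousMap.coe_mk]
    linarith
  · rw [IccExtend_of_mem _ _ ht]
    rfl

theorem nonempty_FS1c_homeomorph_schauderSet : Nonempty (FS1c ≃ₜ schauderSet) := by
  have : CompactSpace FS1c := isCompact_iff_compactSpace.1 isCompact_FS1c
  let Φ : FS1c → schauderSet := fun f =>
    ⟨schauderCoeff (IccExtend Real.pi_pos.le f), schauderCoeff_mem (lipschitzWith_IccExtend f.2)⟩
  have hΦ : Continuous Φ :=
    Continuous.subtype_mk (continuous_pi continuous_schauderCoeff_IccExtend) _
  have hinj : Function.Injective Φ := by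
    intro f g hfg
    have key := fun (t : Icc (0 : ℝ) Real.pi) => sub_eq_of_schauderCoeff_eq
      (lipschitzWith_IccExtend f.2) (lipschitzWith_IccExtend g.2) (Subtype.ext_iff.1 hfg) t.2
    have h₀ : (0 : ℝ) ∈ Icc 0 Real.pi := left_mem_Icc.2 Real.pi_pos.le
    have h₁ : Real.pi ∈ Icc 0 Real.pi := right_mem_Icc.2 Real.pi_pos.le
    simp only [IccExtend_val, IccExtend_of_mem _ _ h₀] at key
    have hend := key ⟨Real.pi, h₁⟩
    have hf := f.2.2
    have hg := g.2.2
    ext t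
    linarith [key t]
  have hsurj : Function.Surjective Φ := by
    intro y
    have hclosed : IsClosed (range Φ) := (isCompact_range hΦ).isClosed
    choose F hF hFy using exists_lipschitz_schauderCoeff_eq y.2
    choose f hf hfF using fun d => exists_mem_FS1c_schauderCoeff_eq (hF d)
    change y ∈ range Φ
    refine hclosed.mem_of_tendsto (f := fun d => Φ ⟨f d, hf d⟩) (b := atTop) ?_
      (Eventually.of_forall fun d => mem_range_self _)
    rw [tendsto_subtype_rng, tendsto_pi_nhds]
    refine fun n => tendsto_const_nhds.congr' ?_
    filter_upwards [eventually_gt_atTop n] with d hd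
    exact ((congrFun (hfF d) n).trans (hFy d n hd)).symm
  exact ⟨Continuous.homeoOfEquivCompactToT2 (f := Equiv.ofBijective Φ ⟨hinj, hsurj⟩) hΦ⟩

end

/-- `F(S¹)` is homeomorphic to the Hilbert cube `∏_{n ∈ ℕ} [0,1]`. -/
theorem FS1_homeomorph_hilbertCube :
    Nonempty (↥FS1c ≃ₜ (ℕ → Set.Icc (0 : ℝ) 1)) := by
  obtain ⟨e⟩ := nonempty_FS1c_homeomorph_schauderSet
  obtain ⟨e'⟩ := nonempty_hilbertCube_homeomorph_schauderSet
  exact ⟨e.trans e'.symm⟩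
end

section
/- Let Q ⊆ ℝⁿ_∞ be compact and nonempty. Then Q, with the metric induced from the ℓ∞ metric, is hyperconvex if and only if Q = ℰ(Q). Moreover, for every compact nonempty X ⊆ ℝⁿ_∞, the set ℰ(X), with the ℓ∞ metric, is hyperconvex. -/
/-- The set `ℰ(X)` of `X`-minimal points of `ℝⁿ_∞` (here `Fin n → ℝ` carries the `ℓ∞`
metric): points `z` such that the distance function `d_∞(z,·)|_X` is minimal. -/
def minimalPts {n : ℕ} (X : Set (Fin n → ℝ)) : Set (Fin n → ℝ) :=
  {z | ∀ x ∈ X, ∃ y ∈ X, dist x z + dist z y = dist x y}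

/-- A metric space `E` is hyperconvex if every family of closed balls whose radii satisfy
the pairwise triangle condition has a common point. -/
def Hyperconvex (E : Type*) [MetricSpace E] : Prop :=
  ∀ (I : Type) (x : I → E) (r : I → ℝ), (∀ i, 0 ≤ r i) →
    (∀ i j, dist (x i) (x j) ≤ r i + r j) → ∃ c : E, ∀ i, dist (x i) c ≤ r i

/-- `ℝⁿ_∞` is hyperconvex, for families indexed by an arbitrary nonempty sort. -/
theorem exists_forall_dist_le_of_dist_le_add {n : ℕ} {ι : Sort*} [Nonempty ι]
    (x : ι → Fin n → ℝ) (r : ι → ℝ) (h : ∀ i j, dist (x i) (x j) ≤ r i + r j) :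
    ∃ c : Fin n → ℝ, ∀ i, dist (x i) c ≤ r i := by
  have hle : ∀ k i j, x i k - r i ≤ x j k + r j := fun k i j ↦ by
    have := (le_abs_self _).trans ((dist_le_pi_dist (x i) (x j) k).trans (h i j))
    linarith
  refine ⟨fun k ↦ ⨆ i, (x i k - r i), fun i ↦ ?_⟩
  have hr : 0 ≤ r i := by
    have := h i i
    rw [dist_self] at this
    linarith
  refine (dist_pi_le_iff hr).2 fun k ↦ ?_
  have h₁ : x i k - r i ≤ ⨆ j, (x j k - r j) :=
    le_ciSup (f := fun j ↦ x j k - r j) ⟨x i k + r i, by rintro _ ⟨j, rfl⟩; exact hle k j i⟩ i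
  have h₂ : ⨆ j, (x j k - r j) ≤ x i k + r i := ciSup_le fun j ↦ hle k j i
  rw [Real.dist_eq, abs_le]
  constructor <;> linarith

/-- In a proper metric space, below every point there is a point whose distance function to a
given nonempty set is minimal among such distance functions. -/
theorem exists_dist_le_and_minimal {α : Type*} [PseudoMetricSpace α] [ProperSpace α]
    {A : Set α} (hA : A.Nonempty) (c : α) :
    ∃ z, (∀ a ∈ A, dist z a ≤ dist c a) ∧
      ∀ w, (∀ a ∈ A, dist w a ≤ dist z a) → ∀ a ∈ A, dist z a ≤ dist w a := by
  let K : α → Set α := fun z ↦ {w | ∀ a ∈ A, dist w a ≤ dist z a}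
  have hK : ∀ z, K z = ⋂ a ∈ A, Metric.closedBall a (dist z a) := fun z ↦ by
    ext w
    simp [K]
  have hclosed : ∀ z, IsClosed (K z) := fun z ↦ by
    rw [hK]
    exact isClosed_biInter fun a _ ↦ Metric.isClosed_closedBall
  have hcompact : ∀ z, IsCompact (K z) := fun z ↦ by
    obtain ⟨a, ha⟩ := hA
    exact (isCompact_closedBall a (dist z a)).of_isClosed_subset (hclosed z) fun w hw ↦ hw a ha
  have hself : ∀ z, z ∈ K z := fun z a _ ↦ le_rfl
  have hmono : ∀ w z, w ∈ K z → K w ⊆ K z := fun w z hw v hv a ha ↦ (hv a ha).trans (hw a ha)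
  obtain ⟨m, hmc, hmin⟩ := zorn_superset_nonempty (Set.range K) (fun C hC hchain hne ↦ by
    have hinter : (⋂₀ C).Nonempty := by
      have := hne.to_subtype
      refine IsCompact.nonempty_sInter_of_directed_nonempty_isCompact_isClosed
        (fun s hs t ht ↦ ?_) ?_ ?_ ?_
      · rcases hchain.total hs ht with h | h
        exacts [⟨s, hs, subset_rfl, h⟩, ⟨t, ht, h, subset_rfl⟩]
      all_goals
        intro s hs
        obtain ⟨z, rfl⟩ := hC hs
      exacts [⟨z, hself z⟩, hcompact z, hclosed z]
    obtain ⟨w, hw⟩ := hinter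
    refine ⟨K w, ⟨w, rfl⟩, fun s hs ↦ ?_⟩
    obtain ⟨z, rfl⟩ := hC hs
    exact hmono w z (hw _ hs)) (K c) ⟨c, rfl⟩
  obtain ⟨z, rfl⟩ := hmin.prop
  exact ⟨z, hmc (hself z), fun w hw ↦ hmin.le_of_le ⟨w, rfl⟩ (hmono w z hw) (hself z)⟩

theorem subset_minimalPts {n : ℕ} (X : Set (Fin n → ℝ)) : X ⊆ minimalPts X :=
  fun z hz x _ ↦ ⟨z, hz, by simp⟩

/-- Below every point of `ℝⁿ_∞` there is an `X`-minimal point, as seen from all `X`-minimal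
points. -/
theorem exists_mem_minimalPts_dist_le {n : ℕ} {X : Set (Fin n → ℝ)} (hX : IsCompact X)
    (hne : X.Nonempty) (c : Fin n → ℝ) :
    ∃ z ∈ minimalPts X, ∀ a ∈ minimalPts X, dist z a ≤ dist c a := by
  obtain ⟨z, hzc, hz⟩ := exists_dist_le_and_minimal (hne.mono (subset_minimalPts X)) c
  refine ⟨z, fun x hx ↦ ?_, hzc⟩
  by_contra! hcon
  obtain ⟨y₀, hy₀, hmin⟩ := hX.exists_isMinOn hne
    (f := fun y ↦ dist x z + dist z y - dist x y) (by fun_prop)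
  let ε := (dist x z + dist z y₀ - dist x y₀) / 2
  have hε : 0 < ε := by
    have := (dist_triangle x z y₀).lt_of_ne (hcon y₀ hy₀).symm
    simp only [ε]
    linarith
  have hX' : ∀ y ∈ X, dist x y + 2 * ε ≤ dist x z + dist z y := fun y hy ↦ by
    have : dist x z + dist z y₀ - dist x y₀ ≤ dist x z + dist z y - dist x y := hmin hy
    simp only [ε]
    linarith
  have hE : ∀ a ∈ minimalPts X, dist x a ≤ dist x z - ε + dist z a := fun a ha ↦ by
    obtain ⟨y, hy, hxy⟩ := ha x hx
    have := hX' y hy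
    have := dist_triangle z a y
    linarith
  have hxz : ε ≤ dist x z := by
    have := hX' x hx
    rw [dist_self, dist_comm z x] at this
    linarith
  obtain ⟨w, hw⟩ := exists_forall_dist_le_of_dist_le_add
    (fun o : Option (minimalPts X) ↦ o.elim x Subtype.val)
    (fun o ↦ o.elim (dist x z - ε) fun a ↦ dist z a) (by
      rintro (_ | a) (_ | b)
      · simpa using hxz
      · exact hE b b.2
      · simpa [dist_comm, add_comm] using hE a a.2
      · exact dist_triangle_left _ _ _)
  have hwx : dist x w ≤ dist x z - ε := hw none
  have hzw := hz w (fun a ha ↦ by simpa [dist_comm] using hw (some ⟨a, ha⟩)) x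
    (subset_minimalPts X hx)
  rw [dist_comm z x, dist_comm w x] at hzw
  linarith

theorem hyperconvex_minimalPts {n : ℕ} {X : Set (Fin n → ℝ)} (hX : IsCompact X)
    (hne : X.Nonempty) : Hyperconvex ↥(minimalPts X) := by
  intro I x r _ h
  rcases isEmpty_or_nonempty I with _ | _
  · obtain ⟨y, hy⟩ := hne
    exact ⟨⟨y, subset_minimalPts X hy⟩, isEmptyElim⟩
  obtain ⟨c, hc⟩ := exists_forall_dist_le_of_dist_le_add (fun i ↦ (x i : Fin n → ℝ)) r h
  obtain ⟨z, hz, hzc⟩ := exists_mem_minimalPts_dist_le hX hne c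
  refine ⟨⟨z, hz⟩, fun i ↦ ?_⟩
  rw [Subtype.dist_eq, dist_comm]
  exact (hzc _ (x i).2).trans ((dist_comm _ _).trans_le (hc i))

theorem Hyperconvex.minimalPts_subset {n : ℕ} {Q : Set (Fin n → ℝ)} (hQ : Hyperconvex ↥Q) :
    minimalPts Q ⊆ Q := by
  intro z hz
  obtain ⟨q, hq⟩ := hQ Q id (fun y ↦ dist z y) (fun _ ↦ dist_nonneg)
    (fun a b ↦ dist_triangle_left (a : Fin n → ℝ) b z)
  obtain ⟨y, hy, h⟩ := hz q q.2
  have hqy : dist (y : Fin n → ℝ) q ≤ dist z y := hq ⟨y, hy⟩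
  rw [dist_comm] at hqy
  have hqz : (q : Fin n → ℝ) = z := dist_le_zero.1 (by linarith)
  exact hqz ▸ q.2

/-- A compact nonempty `Q ⊆ ℝⁿ_∞` is hyperconvex iff `Q = ℰ(Q)`; moreover `ℰ(X)` is
hyperconvex for every compact nonempty `X ⊆ ℝⁿ_∞`. -/
theorem hyperconvex_iff_eq_minimalPts {n : ℕ} :
    (∀ Q : Set (Fin n → ℝ), IsCompact Q → Q.Nonempty →
      (Hyperconvex ↥Q ↔ Q = minimalPts Q)) ∧
    (∀ X : Set (Fin n → ℝ), IsCompact X → X.Nonempty →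
      Hyperconvex ↥(minimalPts X)) := by
  refine ⟨fun Q hQ hne ↦ ⟨fun h ↦ (subset_minimalPts Q).antisymm h.minimalPts_subset, fun h ↦ ?_⟩,
    fun X hX hne ↦ hyperconvex_minimalPts hX hne⟩
  rw [h]
  exact hyperconvex_minimalPts hQ hne
end
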